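/- Let $F \in C([0,1])$ and $H \in C^\infty(\mathbb{R})$ with $H(0) \neq 0$. If for all $s \in [0,1]$, $\int_0^s F(u)\, H\big((su-u^2)^{1/2}\big)\,(su-u^2)^{(n-3)/2}\,du = 0$, where $n \geq 2$ is even, then $F \equiv 0$ on $[0,1]$. -/

import Mathlib

open MeasureTheory Set intervalIntegral Real

/-- The Abel kernel `y ↦ y ^ (-1/2)`, truncated to `(0, 1)`. -/
noncomputable def abelKernel : ℝ → ℝ := indicator (Ioo 0 1) fun y => (√y)⁻¹

lemma abelKernel_of_mem {y : ℝ} (hy : y ∈ Ioo (0 : ℝ) 1) : abelKernel y = (√y)⁻¹ :=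
  indicator_of_mem hy _

lemma abelKernel_of_notMem {y : ℝ} (hy : y ∉ Ioo (0 : ℝ) 1) : abelKernel y = 0 :=
  indicator_of_notMem hy _

lemma abelKernel_nonneg (y : ℝ) : 0 ≤ abelKernel y :=
  indicator_nonneg (fun _ _ => by positivity) _

lemma intervalIntegrable_inv_sqrt (a b : ℝ) :
    IntervalIntegrable (fun y : ℝ => (√y)⁻¹) volume a b := by
  have key : ∀ c : ℝ, 0 ≤ c → IntervalIntegrable (fun y : ℝ => (√y)⁻¹) volume 0 c := by
    intro c hc
    refine (intervalIntegral.intervalIntegrable_rpow' (a := 0) (b := c)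
      (r := -(1 / 2)) (by norm_num)).congr ?_
    intro y hy
    rw [uIoc_of_le hc] at hy
    simp only [sqrt_eq_rpow, rpow_neg hy.1.le]
  have key' : ∀ c : ℝ, IntervalIntegrable (fun y : ℝ => (√y)⁻¹) volume 0 c := by
    intro c
    rcases le_total 0 c with hc | hc
    · exact key c hc
    · refine (IntervalIntegrable.zero (μ := volume) (a := (0 : ℝ)) (b := c) (E := ℝ)).congr ?_
      intro y hy
      rw [uIoc_of_ge hc] at hy
      simp [sqrt_eq_zero_of_nonpos hy.2]
  exact (key' a).symm.trans (key' b)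

lemma integrable_abelKernel : Integrable abelKernel := by
  rw [abelKernel, integrable_indicator_iff measurableSet_Ioo]
  exact ((intervalIntegrable_iff_integrableOn_Ioc_of_le zero_le_one).1
    (intervalIntegrable_inv_sqrt 0 1)).mono_set Ioo_subset_Ioc_self

variable {G : ℝ → ℝ} {q : ℝ → ℝ → ℝ}

lemma exists_bound_unitSquare (hq : Continuous ↿q) :
    ∃ C, 0 < C ∧ ∀ y ∈ Ioo (0 : ℝ) 1, ∀ u ∈ Ioo (0 : ℝ) 1, |q y u| ≤ C := by
  obtain ⟨C, hC⟩ := (isCompact_Icc (a := (0 : ℝ)) (b := 1)).prod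
    (isCompact_Icc (a := (0 : ℝ)) (b := 1)) |>.exists_bound_of_continuousOn hq.continuousOn
  refine ⟨max C 1, by positivity, fun y hy u hu => le_max_of_le_left ?_⟩
  exact hC (y, u) ⟨Ioo_subset_Icc_self hy, Ioo_subset_Icc_self hu⟩

lemma abs_kernel_le {C : ℝ} (hG0 : ∀ u ∉ Ioo (0 : ℝ) 1, G u = 0)
    (hC : ∀ y ∈ Ioo (0 : ℝ) 1, ∀ u ∈ Ioo (0 : ℝ) 1, |q y u| ≤ C) (s u : ℝ) :
    |G u * (abelKernel (s - u) * q (s - u) u)| ≤ C * (|G u| * abelKernel (s - u)) := by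
  by_cases hu : u ∈ Ioo (0 : ℝ) 1
  · by_cases hy : s - u ∈ Ioo (0 : ℝ) 1
    · rw [abs_mul, abs_mul, abs_of_nonneg (abelKernel_nonneg _)]
      have h1 := hC _ hy _ hu
      have h2 : 0 ≤ |G u| * abelKernel (s - u) :=
        mul_nonneg (abs_nonneg _) (abelKernel_nonneg _)
      nlinarith [mul_le_mul_of_nonneg_left h1 h2]
    · simp [abelKernel_of_notMem hy]
  · simp [hG0 u hu]

lemma integrable_abelKernel_mul (hG : Integrable G) (hG0 : ∀ u ∉ Ioo (0 : ℝ) 1, G u = 0)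
    (hq : Continuous ↿q) :
    Integrable (fun p : ℝ × ℝ => G p.2 * (abelKernel (p.1 - p.2) * q (p.1 - p.2) p.2))
      (volume.prod volume) := by
  obtain ⟨C, -, hC⟩ := exists_bound_unitSquare hq
  have h1 := hG.convolution_integrand (ContinuousLinearMap.mul ℝ ℝ) integrable_abelKernel
  have h2 := hG.abs.convolution_integrand (ContinuousLinearMap.mul ℝ ℝ) integrable_abelKernel
  have hqc : Continuous fun p : ℝ × ℝ => q (p.1 - p.2) p.2 :=
    hq.comp ((continuous_fst.sub continuous_snd).prodMk continuous_snd)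
  refine (h2.const_mul C).mono' ?_ (Filter.Eventually.of_forall fun p => ?_)
  · convert h1.aestronglyMeasurable.mul hqc.aestronglyMeasurable using 2 with p
    simp [mul_assoc]
  · simpa using abs_kernel_le hG0 hC p.1 p.2

lemma integral_abelKernel_mul (hG0 : ∀ u ∉ Ioo (0 : ℝ) 1, G u = 0) {s : ℝ}
    (hs : s ∈ Ioo (0 : ℝ) 1) :
    ∫ u, G u * (abelKernel (s - u) * q (s - u) u) =
      ∫ u in (0 : ℝ)..s, G u * ((√(s - u))⁻¹ * q (s - u) u) := by
  rw [integral_of_le hs.1.le, integral_Ioc_eq_integral_Ioo,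
    ← setIntegral_eq_integral_of_forall_compl_eq_zero (s := Ioo 0 s)]
  · refine setIntegral_congr_fun measurableSet_Ioo fun u hu => ?_
    rw [abelKernel_of_mem ⟨by linarith [hu.2], by linarith [hu.1, hs.2]⟩]
  · intro u hu
    by_cases h : u ∈ Ioo (0 : ℝ) 1
    · rw [abelKernel_of_notMem fun h' => hu ⟨h.1, by linarith [h'.1]⟩]
      simp
    · simp [hG0 u h]

lemma ae_eq_zero_of_integral_eq_zero {D : ℝ → ℝ} (hD : Integrable D)
    (h : ∀ᵐ t, t ∈ Ioo (0 : ℝ) 1 → ∫ s in (0 : ℝ)..t, D s = 0) :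
    ∀ᵐ s, s ∈ Ioo (0 : ℝ) 1 → D s = 0 := by
  have hcont : Continuous fun t => ∫ s in (0 : ℝ)..t, D s :=
    continuous_primitive (fun _ _ => hD.intervalIntegrable) 0
  have hzero : EqOn (fun t => ∫ s in (0 : ℝ)..t, D s) (fun _ => 0) (Ioo 0 1) :=
    Measure.eqOn_open_of_ae_eq ((ae_restrict_iff' measurableSet_Ioo).2 h) isOpen_Ioo
      hcont.continuousOn continuousOn_const
  filter_upwards [LocallyIntegrable.ae_hasDerivAt_integral hD.locallyIntegrable] with s hs hs'
  refine (hs 0).unique ((hasDerivAt_const s (0 : ℝ)).congr_of_eventuallyEq ?_)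
  filter_upwards [isOpen_Ioo.mem_nhds hs'] with t ht using hzero ht

/-- Differentiation of the Volterra equation `∫₀ᵗ G(u) k(t - u, u) du = 0` whose kernel is
`k(y, u) = c + ∫₀ʸ z ^ (-1/2) q(z, u) dz`. -/
lemma ae_deriv_volterra (hG : Integrable G) (hG0 : ∀ u ∉ Ioo (0 : ℝ) 1, G u = 0)
    (hq : Continuous ↿q) (c : ℝ) {k : ℝ → ℝ → ℝ}
    (hk : ∀ u ∈ Ioo (0 : ℝ) 1, ∀ y ∈ Ioo (0 : ℝ) 1,
      k y u = c + ∫ z in (0 : ℝ)..y, (√z)⁻¹ * q z u)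
    (h : ∀ᵐ t, t ∈ Ioo (0 : ℝ) 1 → ∫ u in (0 : ℝ)..t, G u * k (t - u) u = 0) :
    ∀ᵐ s, s ∈ Ioo (0 : ℝ) 1 →
      c * G s + ∫ u in (0 : ℝ)..s, G u * ((√(s - u))⁻¹ * q (s - u) u) = 0 := by
  have hK := integrable_abelKernel_mul hG hG0 hq
  set D : ℝ → ℝ := fun s => c * G s + ∫ u, G u * (abelKernel (s - u) * q (s - u) u) with hDdef
  have hD' : Integrable fun s => ∫ u, G u * (abelKernel (s - u) * q (s - u) u) :=
    hK.integral_prod_left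
  have hD : Integrable D := (hG.const_mul c).add hD'
  have hD0 : ∀ᵐ s, s ∈ Ioo (0 : ℝ) 1 → D s = 0 := by
    refine ae_eq_zero_of_integral_eq_zero hD ?_
    filter_upwards [h] with t ht ht1
    refine Eq.trans ?_ (ht ht1)
    have hKt : Integrable (fun p : ℝ × ℝ => G p.2 * (abelKernel (p.1 - p.2) * q (p.1 - p.2) p.2))
        ((volume.restrict (Ioc 0 t)).prod volume) := by
      have := hK.restrict (s := Ioc 0 t ×ˢ univ)
      rwa [← Measure.prod_restrict, Measure.restrict_univ] at this
    rw [hDdef, intervalIntegral.integral_add (hG.const_mul c).intervalIntegrable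
      hD'.intervalIntegrable]
    have hswap : ∫ s in (0 : ℝ)..t, ∫ u, G u * (abelKernel (s - u) * q (s - u) u) =
        ∫ u, ∫ s in (0 : ℝ)..t, G u * (abelKernel (s - u) * q (s - u) u) := by
      simp only [integral_of_le ht1.1.le]
      exact integral_integral_swap hKt
    have hinner : ∀ u ∈ Ioo (0 : ℝ) 1, u < t →
        ∫ s in (0 : ℝ)..t, G u * (abelKernel (s - u) * q (s - u) u) =
          G u * ∫ z in (0 : ℝ)..(t - u), (√z)⁻¹ * q z u := by
      intro u hu hut
      rw [intervalIntegral.integral_const_mul,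
        intervalIntegral.integral_comp_sub_right (fun z => abelKernel z * q z u) u,
        integral_of_le (by linarith [ht1.1] : (0 : ℝ) - u ≤ t - u),
        integral_of_le (by linarith : (0 : ℝ) ≤ t - u)]
      congr 1
      rw [setIntegral_eq_of_subset_of_forall_sdiff_eq_zero (s := Ioc 0 (t - u)) measurableSet_Ioc
        (Ioc_subset_Ioc_left (by linarith [hu.1]))]
      · refine setIntegral_congr_fun measurableSet_Ioc fun z hz => ?_
        simp only [abelKernel_of_mem ⟨hz.1, by linarith [hz.2, ht1.2, hu.1]⟩]
      · intro z hz
        rw [abelKernel_of_notMem fun h' => hz.2 ⟨h'.1, hz.1.2⟩, zero_mul]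
    have hout : ∀ u ∉ Ioo 0 t,
        ∫ s in (0 : ℝ)..t, G u * (abelKernel (s - u) * q (s - u) u) = 0 := by
      intro u hu
      by_cases hu1 : u ∈ Ioo (0 : ℝ) 1
      · rw [integral_of_le ht1.1.le]
        refine setIntegral_eq_zero_of_forall_eq_zero fun s hs => ?_
        rw [abelKernel_of_notMem fun h' => hu ⟨hu1.1, by linarith [h'.1, hs.2]⟩]
        simp
      · simp [hG0 u hu1]
    rw [hswap, ← setIntegral_eq_integral_of_forall_compl_eq_zero hout,
      ← integral_Ioc_eq_integral_Ioo, ← integral_of_le ht1.1.le,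
      ← intervalIntegral.integral_add (hG.const_mul c).intervalIntegrable]
    · simp only [integral_of_le ht1.1.le, integral_Ioc_eq_integral_Ioo]
      refine setIntegral_congr_fun measurableSet_Ioo fun u hu => ?_
      have hu1 : u ∈ Ioo (0 : ℝ) 1 := ⟨hu.1, hu.2.trans ht1.2⟩
      have := hinner u hu1 hu.2
      simp only [integral_of_le ht1.1.le, integral_Ioc_eq_integral_Ioo] at this
      rw [this, hk u hu1 _ ⟨by linarith [hu.2], by linarith [hu1.1, ht1.2]⟩]
      ring
    · simp only [integral_of_le ht1.1.le]
      exact hKt.integral_prod_right.intervalIntegrable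
  filter_upwards [hD0] with s hs hs1
  rw [← integral_abelKernel_mul hG0 hs1]
  exact hs hs1

lemma setIntegral_abel {d : ℝ} (hd : 0 < d) (f : ℝ → ℝ) :
    ∫ y in Ioo 0 d, (√(d - y))⁻¹ * ((√y)⁻¹ * f y) =
      2 * ∫ θ in (0 : ℝ)..(π / 2), f (d * sin θ ^ 2) := by
  have hpi := pi_pos
  have hsin : ∀ θ ∈ Ioo 0 (π / 2), 0 < sin θ := fun θ hθ =>
    sin_pos_of_pos_of_lt_pi hθ.1 (by linarith [hθ.2])
  have hcos : ∀ θ ∈ Ioo 0 (π / 2), 0 < cos θ := fun θ hθ =>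
    cos_pos_of_mem_Ioo ⟨by linarith [hθ.1], hθ.2⟩
  have himage : (fun θ => d * sin θ ^ 2) '' Ioo 0 (π / 2) = Ioo 0 d := by
    ext y
    constructor
    · rintro ⟨θ, hθ, rfl⟩
      have h1 := hsin θ hθ
      have h2 := hcos θ hθ
      refine ⟨by positivity, ?_⟩
      nlinarith [sin_sq_add_cos_sq θ, mul_pos hd (pow_pos h2 2)]
    · intro hy
      have h0 : 0 < √(y / d) := sqrt_pos.2 (div_pos hy.1 hd)
      have h1 : √(y / d) < 1 := by
        rw [sqrt_lt' one_pos, one_pow, div_lt_one hd]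
        exact hy.2
      refine ⟨arcsin √(y / d), ⟨arcsin_pos.2 h0, arcsin_lt_pi_div_two.2 h1⟩, ?_⟩
      simp only
      rw [sin_arcsin (by linarith) h1.le, sq_sqrt (div_pos hy.1 hd).le]
      field_simp
  have hinj : InjOn (fun θ => d * sin θ ^ 2) (Ioo 0 (π / 2)) := by
    intro a ha b hb hab
    have h1 : sin a = sin b := by
      have := mul_left_cancel₀ hd.ne' hab
      exact (pow_left_inj₀ (hsin a ha).le (hsin b hb).le two_ne_zero).1 this
    exact injOn_sin ⟨by linarith [ha.1], ha.2.le⟩ ⟨by linarith [hb.1], hb.2.le⟩ h1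
  have hderiv : ∀ θ ∈ Ioo 0 (π / 2), HasDerivWithinAt (fun θ => d * sin θ ^ 2)
      (d * (2 * sin θ * cos θ)) (Ioo 0 (π / 2)) θ := by
    intro θ _
    simpa using (((hasDerivAt_sin θ).pow 2).const_mul d).hasDerivWithinAt
  rw [← himage, integral_image_eq_integral_abs_deriv_smul measurableSet_Ioo hderiv hinj,
    integral_of_le (by positivity), integral_Ioc_eq_integral_Ioo,
    ← MeasureTheory.integral_const_mul]
  refine setIntegral_congr_fun measurableSet_Ioo fun θ hθ => ?_
  have h1 := hsin θ hθ
  have h2 := hcos θ hθ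
  have h3 : d - d * sin θ ^ 2 = d * cos θ ^ 2 := by rw [cos_sq']; ring
  have h4 := sqrt_pos.2 hd
  simp only [smul_eq_mul]
  rw [h3, sqrt_mul hd.le, sqrt_mul hd.le, sqrt_sq h1.le, sqrt_sq h2.le,
    abs_of_pos (by positivity)]
  field_simp
  rw [sq_sqrt hd.le]

/-- Twice the integral of `θ ↦ ψ(x sin θ)` over a quarter period. -/
noncomputable def sineMean (ψ : ℝ → ℝ) (x : ℝ) : ℝ := 2 * ∫ θ in (0 : ℝ)..(π / 2), ψ (x * sin θ)

lemma integral_abelKernel_mul_abelKernel (ψ : ℝ → ℝ) {u t : ℝ} (hu : 0 < u) (hut : u < t)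
    (ht : t < 1) :
    ∫ s, abelKernel (t - s) * (abelKernel (s - u) * ψ √(u * (s - u))) =
      sineMean ψ √(u * (t - u)) := by
  have hd : 0 < t - u := sub_pos.2 hut
  have hshift := integral_add_right_eq_self (μ := volume)
    (fun s => abelKernel (t - s) * (abelKernel (s - u) * ψ √(u * (s - u)))) u
  rw [← hshift, ← setIntegral_eq_integral_of_forall_compl_eq_zero (s := Ioo 0 (t - u))]
  · trans ∫ y in Ioo 0 (t - u), (√(t - u - y))⁻¹ * ((√y)⁻¹ * ψ √(u * y))
    · refine setIntegral_congr_fun measurableSet_Ioo fun y hy => ?_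
      have h1 : t - (y + u) = t - u - y := by ring
      simp only [add_sub_cancel_right, h1]
      rw [abelKernel_of_mem ⟨by linarith [hy.2], by linarith [hy.1]⟩,
        abelKernel_of_mem ⟨hy.1, by linarith [hy.2]⟩]
    · rw [setIntegral_abel hd fun y => ψ √(u * y), sineMean]
      congr 1
      refine integral_congr fun θ hθ => ?_
      rw [uIcc_of_le (by positivity)] at hθ
      have : 0 ≤ sin θ := sin_nonneg_of_nonneg_of_le_pi hθ.1 (by linarith [hθ.2, pi_pos])
      rw [← mul_assoc, sqrt_mul (mul_pos hu hd).le, sqrt_sq this]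
  · intro y hy
    by_cases h : 0 < y
    · rw [abelKernel_of_notMem fun h' => hy ⟨h, by linarith [h'.1]⟩, zero_mul]
    · rw [abelKernel_of_notMem (y := y + u - u) fun h' => h (by linarith [h'.1])]
      simp

/-- Composition with the Abel operator turns the kernel `y ^ (-1/2) ψ(√(u y))` into the bounded
kernel `sineMean ψ (√(u y))`. -/
lemma ae_abel_volterra (hG : Integrable G) (hG0 : ∀ u ∉ Ioo (0 : ℝ) 1, G u = 0) {ψ : ℝ → ℝ}
    (hψ : Continuous ψ)
    (h : ∀ᵐ s, s ∈ Ioo (0 : ℝ) 1 →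
      ∫ u in (0 : ℝ)..s, G u * ((√(s - u))⁻¹ * ψ √(u * (s - u))) = 0) :
    ∀ᵐ t, t ∈ Ioo (0 : ℝ) 1 →
      ∫ u in (0 : ℝ)..t, G u * sineMean ψ √(u * (t - u)) = 0 := by
  have hK := integrable_abelKernel_mul (q := fun y u => ψ √(u * y)) hG hG0
    (hψ.comp (continuous_snd.mul continuous_fst).sqrt)
  have hconv := hK.integral_norm_prod_left.ae_convolution_exists
    (ContinuousLinearMap.mul ℝ ℝ) integrable_abelKernel
  filter_upwards [hconv] with t ht ht1
  have hKt : Integrable (fun p : ℝ × ℝ => abelKernel (t - p.1) *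
      (G p.2 * (abelKernel (p.1 - p.2) * ψ √(p.2 * (p.1 - p.2))))) (volume.prod volume) := by
    have hmeas : AEStronglyMeasurable (fun p : ℝ × ℝ => abelKernel (t - p.1))
        (volume.prod volume) :=
      (integrable_abelKernel.comp_sub_left t).aestronglyMeasurable.comp_fst
    refine (integrable_prod_iff (hmeas.mul hK.aestronglyMeasurable)).2 ⟨?_, ?_⟩
    · filter_upwards [((integrable_prod_iff hK.aestronglyMeasurable).1 hK).1] with s hs
      exact hs.const_mul (abelKernel (t - s))
    · refine ht.congr (Filter.Eventually.of_forall fun s => ?_)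
      simp only [Pi.mul_apply, norm_mul (abelKernel (t - s)), MeasureTheory.integral_const_mul,
        norm_of_nonneg (abelKernel_nonneg _), ContinuousLinearMap.mul_apply']
      exact mul_comm _ _
  have hswap : ∫ s, ∫ u, abelKernel (t - s) *
      (G u * (abelKernel (s - u) * ψ √(u * (s - u)))) = ∫ u, ∫ s, abelKernel (t - s) *
      (G u * (abelKernel (s - u) * ψ √(u * (s - u)))) := integral_integral_swap hKt
  have hleft : ∫ s, ∫ u, abelKernel (t - s) *
      (G u * (abelKernel (s - u) * ψ √(u * (s - u)))) = 0 := by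
    refine integral_eq_zero_of_ae ?_
    filter_upwards [h] with s hs
    rw [MeasureTheory.integral_const_mul]
    by_cases hts : t - s ∈ Ioo (0 : ℝ) 1
    · by_cases hs0 : 0 < s
      · have hs1 : s ∈ Ioo (0 : ℝ) 1 := ⟨hs0, by linarith [hts.1, ht1.2]⟩
        have := integral_abelKernel_mul (q := fun y u => ψ √(u * y)) hG0 hs1
        rw [this, hs hs1]
        simp
      · have : ∀ u, G u * (abelKernel (s - u) * ψ √(u * (s - u))) = 0 := by
          intro u
          by_cases hu : u ∈ Ioo (0 : ℝ) 1
          · rw [abelKernel_of_notMem fun h' => hs0 (by linarith [h'.1, hu.1])]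
            simp
          · simp [hG0 u hu]
        simp [this]
    · simp [abelKernel_of_notMem hts]
  have hright : ∫ u, ∫ s, abelKernel (t - s) *
      (G u * (abelKernel (s - u) * ψ √(u * (s - u)))) =
      ∫ u in (0 : ℝ)..t, G u * sineMean ψ √(u * (t - u)) := by
    rw [integral_of_le ht1.1.le, integral_Ioc_eq_integral_Ioo,
      ← setIntegral_eq_integral_of_forall_compl_eq_zero (s := Ioo 0 t)]
    · refine setIntegral_congr_fun measurableSet_Ioo fun u hu => ?_
      simp only [mul_left_comm _ (G u), MeasureTheory.integral_const_mul]
      rw [integral_abelKernel_mul_abelKernel ψ hu.1 hu.2 ht1.2]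
    · intro u hu
      refine integral_eq_zero_of_ae (Filter.Eventually.of_forall fun s => ?_)
      by_cases hu1 : u ∈ Ioo (0 : ℝ) 1
      · by_cases hts : t - s ∈ Ioo (0 : ℝ) 1
        · simp [abelKernel_of_notMem (y := s - u)
            fun h' => hu ⟨hu1.1, by linarith [h'.1, hts.1]⟩]
        · simp [abelKernel_of_notMem hts]
      · simp [hG0 u hu1]
  rw [← hright, ← hswap]
  exact hleft

lemma sineMean_zero (ψ : ℝ → ℝ) : sineMean ψ 0 = π * ψ 0 := by
  simp only [sineMean, zero_mul, intervalIntegral.integral_const, smul_eq_mul]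
  ring

lemma hasDerivAt_sineMean {ψ : ℝ → ℝ} (hψ : ContDiff ℝ 1 ψ) (x : ℝ) :
    HasDerivAt (sineMean ψ)
      (2 * ∫ θ in (0 : ℝ)..(π / 2), deriv ψ (x * sin θ) * sin θ) x := by
  have hψ' : Continuous (deriv ψ) := hψ.continuous_deriv le_rfl
  have hψc : Continuous ψ := hψ.continuous
  obtain ⟨C, hC⟩ := (isCompact_Icc (a := -(|x| + 1)) (b := |x| + 1)).exists_bound_of_continuousOn
    hψ'.continuousOn
  refine HasDerivAt.const_mul 2 (intervalIntegral.hasDerivAt_integral_of_dominated_loc_of_deriv_le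
    (F := fun x θ => ψ (x * sin θ)) (F' := fun x θ => deriv ψ (x * sin θ) * sin θ)
    (bound := fun _ => C) (Metric.ball_mem_nhds x one_pos) ?_ ?_ ?_ ?_ ?_ ?_).2
  · exact Filter.Eventually.of_forall fun y => (by fun_prop : Continuous _).aestronglyMeasurable
  · exact (by fun_prop : Continuous _).intervalIntegrable _ _
  · exact (by fun_prop : Continuous _).aestronglyMeasurable
  · refine Filter.Eventually.of_forall fun θ _ y hy => ?_
    have h1 : |y| ≤ |x| + 1 := by
      have : |y - x| < 1 := by simpa [Real.dist_eq] using hy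
      have := abs_sub_abs_le_abs_sub y x
      linarith
    have h2 : |y * sin θ| ≤ |x| + 1 := by
      rw [abs_mul]
      nlinarith [abs_sin_le_one θ, abs_nonneg y]
    have h3 := hC (y * sin θ) (abs_le.1 h2)
    rw [norm_mul]
    nlinarith [abs_sin_le_one θ, norm_nonneg (deriv ψ (y * sin θ)), Real.norm_eq_abs (sin θ)]
  · exact intervalIntegrable_const
  · refine Filter.Eventually.of_forall fun θ _ y _ => ?_
    have h1 := ((hψ.differentiable one_ne_zero) (y * sin θ)).hasDerivAt
    exact h1.comp y (hasDerivAt_mul_const (sin θ))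

lemma continuous_deriv_sineMean {ψ : ℝ → ℝ} (hψ : ContDiff ℝ 1 ψ) :
    Continuous (deriv (sineMean ψ)) := by
  have hψ' : Continuous (deriv ψ) := hψ.continuous_deriv le_rfl
  rw [funext fun x => (hasDerivAt_sineMean hψ x).deriv]
  refine continuous_const.mul (continuous_parametric_intervalIntegral_of_continuous' ?_ _ _)
  fun_prop

lemma hasDerivAt_comp_sqrt_mul {Ψ : ℝ → ℝ} (hΨ : Differentiable ℝ Ψ) {u z : ℝ} (hu : 0 < u)
    (hz : 0 < z) :
    HasDerivAt (fun z => Ψ √(u * z)) ((√z)⁻¹ * (√u / 2 * deriv Ψ √(u * z))) z := by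
  have h1 : HasDerivAt (fun z => √(u * z)) (u / (2 * √(u * z))) z := by
    simpa using ((hasDerivAt_id z).const_mul u).sqrt (mul_pos hu hz).ne'
  convert! (hΨ √(u * z)).hasDerivAt.comp z h1 using 1
  have h2 := sqrt_pos.2 hu
  have h3 := sqrt_pos.2 hz
  rw [sqrt_mul hu.le]
  field_simp
  rw [sq_sqrt hu.le, mul_comm]

lemma integral_deriv_comp_sqrt_mul {Ψ : ℝ → ℝ} (hΨ : Differentiable ℝ Ψ)
    (hΨ' : Continuous (deriv Ψ)) {u y : ℝ} (hu : 0 < u) (hy : 0 < y) :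
    ∫ z in (0 : ℝ)..y, (√z)⁻¹ * (√u / 2 * deriv Ψ √(u * z)) = Ψ √(u * y) - Ψ 0 := by
  have hΨc : Continuous Ψ := hΨ.continuous
  rw [integral_eq_sub_of_hasDerivAt_of_le hy.le (f := fun z => Ψ √(u * z))
    (by fun_prop : Continuous _).continuousOn
    (fun z hz => hasDerivAt_comp_sqrt_mul hΨ hu hz.1)]
  · simp
  · exact (intervalIntegrable_inv_sqrt 0 y).mul_continuousOn
      (by fun_prop : Continuous _).continuousOn

lemma integral_deriv_sqrt_mul_pow {Ψ : ℝ → ℝ} (hΨ : Differentiable ℝ Ψ)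
    (hΨ' : Continuous (deriv Ψ)) (j : ℕ) {u y : ℝ} (hu : 0 < u) (hy : 0 < y) :
    ∫ z in (0 : ℝ)..y, (√z)⁻¹ * (z ^ j *
      ((j + 1 / 2) * Ψ √(u * z) + √(u * z) / 2 * deriv Ψ √(u * z))) =
      (√y)⁻¹ * (y ^ (j + 1) * Ψ √(u * y)) := by
  have hΨc : Continuous Ψ := hΨ.continuous
  rw [integral_eq_sub_of_hasDerivAt_of_le hy.le (f := fun z => √z * z ^ j * Ψ √(u * z))
    (by fun_prop : Continuous _).continuousOn]
  · have h1 := sqrt_pos.2 hy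
    simp only [sqrt_zero, zero_mul, sub_zero]
    field_simp
    rw [sq_sqrt hy.le]
    ring
  · intro z hz
    have h0 := hz.1
    have h1 := sqrt_pos.2 h0
    have hd : HasDerivAt (fun z => √z * z ^ j)
        (1 / (2 * √z) * z ^ j + √z * (j * z ^ (j - 1))) z :=
      (hasDerivAt_sqrt h0.ne').mul (hasDerivAt_pow j z)
    refine (hd.mul (hasDerivAt_comp_sqrt_mul hΨ hu h0)).congr_deriv ?_
    have h2 : √(u * z) = √u * √z := sqrt_mul hu.le z
    have h3 : (j : ℝ) * z ^ j = j * z ^ (j - 1) * √z ^ 2 := by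
      rw [sq_sqrt h0.le]
      rcases j with _ | j
      · simp
      · simp [pow_succ, mul_assoc]
    have h4 : (√z)⁻¹ * (j * z ^ j) = √z * (j * z ^ (j - 1)) := by
      rw [h3]
      field_simp
    rw [← h4, h2]
    field_simp
    ring
  · exact (intervalIntegrable_inv_sqrt 0 y).mul_continuousOn
      (by fun_prop : Continuous _).continuousOn

lemma exists_abel_volterra (hG : Integrable G) (hG0 : ∀ u ∉ Ioo (0 : ℝ) 1, G u = 0) (j : ℕ) :
    ∀ Ψ : ℝ → ℝ, ContDiff ℝ (⊤ : ℕ∞) Ψ → Ψ 0 ≠ 0 →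
      (∀ᵐ s, s ∈ Ioo (0 : ℝ) 1 → ∫ u in (0 : ℝ)..s,
        G u * ((√(s - u))⁻¹ * ((s - u) ^ j * Ψ √(u * (s - u)))) = 0) →
      ∃ ψ : ℝ → ℝ, ContDiff ℝ (⊤ : ℕ∞) ψ ∧ ψ 0 ≠ 0 ∧ ∀ᵐ s, s ∈ Ioo (0 : ℝ) 1 →
        ∫ u in (0 : ℝ)..s, G u * ((√(s - u))⁻¹ * ψ √(u * (s - u))) = 0 := by
  induction j with
  | zero => exact fun Ψ h1 h2 h3 => ⟨Ψ, h1, h2, by simpa using h3⟩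
  | succ j ih =>
    intro Ψ h1 h2 h3
    have hd : ContDiff ℝ (⊤ : ℕ∞) (deriv Ψ) := (contDiff_infty_iff_deriv.1 h1).2
    have hdiff : Differentiable ℝ Ψ := (contDiff_infty_iff_deriv.1 h1).1
    have hdc : Continuous (deriv Ψ) := hd.continuous
    have hΨc : Continuous Ψ := hdiff.continuous
    refine ih (fun x => (j + 1 / 2) * Ψ x + x / 2 * deriv Ψ x) (by fun_prop) ?_ ?_
    · have : (j : ℝ) + 1 / 2 ≠ 0 := by positivity
      simpa using ⟨by simpa using this, h2⟩
    · have := ae_deriv_volterra (q := fun y u => y ^ j *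
        ((j + 1 / 2) * Ψ √(u * y) + √(u * y) / 2 * deriv Ψ √(u * y))) hG hG0
        (by simp only [Function.HasUncurry.uncurry]; fun_prop) 0
        (k := fun y u => (√y)⁻¹ * (y ^ (j + 1) * Ψ √(u * y)))
        (fun u hu y hy => by
          rw [integral_deriv_sqrt_mul_pow hdiff hdc j hu.1 hy.1, zero_add]) h3
      simpa using this

lemma integrable_exp_mul (hG : Integrable G) (hG0 : ∀ u ∉ Ioo (0 : ℝ) 1, G u = 0) (n : ℕ) :
    Integrable fun u => exp (-(n * u)) * G u := by
  refine hG.norm.mono' ((by fun_prop : Continuous _).aestronglyMeasurable.mul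
    hG.aestronglyMeasurable) (Filter.Eventually.of_forall fun u => ?_)
  by_cases hu : u ∈ Ioo (0 : ℝ) 1
  · rw [norm_mul, norm_of_nonneg (exp_pos _).le]
    have h0 := hu.1
    exact mul_le_of_le_one_left (norm_nonneg _)
      (exp_le_one_iff.2 (neg_nonpos.2 (by positivity)))
  · simp [hG0 u hu]

lemma tendsto_integral_exp_mul_abelKernel :
    Filter.Tendsto (fun n : ℕ => ∫ y, exp (-(n * y)) * abelKernel y) Filter.atTop (nhds 0) := by
  have hb : ∀ u ∉ Ioo (0 : ℝ) 1, abelKernel u = 0 := fun u hu => abelKernel_of_notMem hu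
  rw [← integral_zero ℝ ℝ (μ := volume)]
  refine tendsto_integral_of_dominated_convergence abelKernel
    (fun n => (integrable_exp_mul integrable_abelKernel hb n).aestronglyMeasurable)
    integrable_abelKernel (fun n => Filter.Eventually.of_forall fun y => ?_)
    (Filter.Eventually.of_forall fun y => ?_)
  · by_cases hy : y ∈ Ioo (0 : ℝ) 1
    · have h0 := hy.1
      rw [norm_mul, norm_of_nonneg (exp_pos _).le, norm_of_nonneg (abelKernel_nonneg _)]
      exact mul_le_of_le_one_left (abelKernel_nonneg _)
        (exp_le_one_iff.2 (neg_nonpos.2 (by positivity)))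
    · simp [hb y hy]
  · by_cases hy : y ∈ Ioo (0 : ℝ) 1
    · have h1 : Filter.Tendsto (fun n : ℕ => exp (-(n * y))) Filter.atTop (nhds 0) :=
        tendsto_exp_neg_atTop_nhds_zero.comp
          (tendsto_natCast_atTop_atTop.atTop_mul_const hy.1)
      simpa using h1.mul_const (abelKernel y)
    · simp [hb y hy]

/-- Uniqueness for the weakly singular Volterra equation of the second kind. -/
lemma ae_eq_zero_of_volterra (hG : Integrable G) (hG0 : ∀ u ∉ Ioo (0 : ℝ) 1, G u = 0)
    (hq : Continuous ↿q) {c : ℝ} (hc : c ≠ 0)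
    (h : ∀ᵐ s, s ∈ Ioo (0 : ℝ) 1 →
      c * G s + ∫ u in (0 : ℝ)..s, G u * ((√(s - u))⁻¹ * q (s - u) u) = 0) :
    G =ᵐ[volume] 0 := by
  obtain ⟨C, hCpos, hC⟩ := exists_bound_unitSquare hq
  have hb0 : ∀ u ∉ Ioo (0 : ℝ) 1, abelKernel u = 0 := fun u hu => abelKernel_of_notMem hu
  have hGa0 : ∀ u ∉ Ioo (0 : ℝ) 1, |G u| = 0 := fun u hu => by rw [hG0 u hu, abs_zero]
  obtain ⟨n, hn⟩ := (tendsto_integral_exp_mul_abelKernel.eventually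
    (gt_mem_nhds (div_pos (abs_pos.2 hc) hCpos))).exists
  have hg := integrable_exp_mul hG.abs hGa0 n
  have hb := integrable_exp_mul integrable_abelKernel hb0 n
  set g : ℝ → ℝ := fun u => exp (-(n * u)) * |G u| with hgdef
  set b : ℝ → ℝ := fun y => exp (-(n * y)) * abelKernel y with hbdef
  have hg_nonneg : ∀ u, 0 ≤ g u := fun u => mul_nonneg (exp_pos _).le (abs_nonneg _)
  have hb_nonneg : ∀ u, 0 ≤ b u := fun u => mul_nonneg (exp_pos _).le (abelKernel_nonneg _)
  have hmul : ∀ s u, g u * b (s - u) = exp (-(n * s)) * (|G u| * abelKernel (s - u)) := by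
    intro s u
    have : exp (-(n * s)) = exp (-(n * u)) * exp (-(n * (s - u))) := by
      rw [← exp_add]
      ring_nf
    rw [this, hgdef, hbdef]
    ring
  have hle : ∀ᵐ s, |c| * g s ≤ C * ∫ u, g u * b (s - u) := by
    filter_upwards [h, hG.abs.ae_convolution_exists (ContinuousLinearMap.mul ℝ ℝ)
      integrable_abelKernel] with s hs hint
    by_cases hs1 : s ∈ Ioo (0 : ℝ) 1
    · have h1 := hs hs1
      rw [← integral_abelKernel_mul hG0 hs1] at h1
      have h2 : |c| * |G s| ≤ C * ∫ u, |G u| * abelKernel (s - u) := by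
        rw [← abs_mul, eq_neg_of_add_eq_zero_left h1, abs_neg,
          ← MeasureTheory.integral_const_mul, ← Real.norm_eq_abs]
        refine norm_integral_le_of_norm_le (g := fun u => C * (|G u| * abelKernel (s - u)))
          (hint.const_mul C) (Filter.Eventually.of_forall (abs_kernel_le hG0 hC s))
      simp only [hmul, MeasureTheory.integral_const_mul]
      have := mul_le_mul_of_nonneg_left h2 (exp_pos (-(n * s))).le
      calc |c| * g s = exp (-(n * s)) * (|c| * |G s|) := by rw [hgdef]; ring
        _ ≤ _ := this
        _ = _ := by ring
    · have : g s = 0 := by simp [hgdef, hG0 s hs1]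
      rw [this, mul_zero]
      exact mul_nonneg hCpos.le (integral_nonneg fun u => mul_nonneg (hg_nonneg _) (hb_nonneg _))
  have hconv : ∫ s, ∫ u, g u * b (s - u) = (∫ u, g u) * ∫ y, b y :=
    integral_convolution (ContinuousLinearMap.mul ℝ ℝ) hg hb
  have hconv_int : Integrable fun s => ∫ u, g u * b (s - u) :=
    hg.integrable_convolution (ContinuousLinearMap.mul ℝ ℝ) hb
  have hkey := integral_mono_ae (hg.const_mul |c|) (hconv_int.const_mul C) hle
  rw [MeasureTheory.integral_const_mul, MeasureTheory.integral_const_mul, hconv] at hkey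
  have hzero : ∫ u, g u = 0 := by
    have h0 : 0 ≤ ∫ u, g u := integral_nonneg hg_nonneg
    have h1 : (∫ y, b y) * C < |c| := (lt_div_iff₀ hCpos).1 hn
    by_contra hne
    have h2 : 0 < ∫ u, g u := lt_of_le_of_ne h0 (Ne.symm hne)
    nlinarith
  filter_upwards [(integral_eq_zero_iff_of_nonneg hg_nonneg hg).1 hzero] with u hu
  simpa [hgdef, (exp_pos _).ne'] using hu

lemma ae_eq_zero_of_abel_volterra (hG : Integrable G) (hG0 : ∀ u ∉ Ioo (0 : ℝ) 1, G u = 0)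
    {ψ : ℝ → ℝ} (hψ : ContDiff ℝ 1 ψ) (hψ0 : ψ 0 ≠ 0)
    (h : ∀ᵐ s, s ∈ Ioo (0 : ℝ) 1 →
      ∫ u in (0 : ℝ)..s, G u * ((√(s - u))⁻¹ * ψ √(u * (s - u))) = 0) :
    G =ᵐ[volume] 0 := by
  have hdiff : Differentiable ℝ (sineMean ψ) := fun x =>
    (hasDerivAt_sineMean hψ x).differentiableAt
  have hcont := continuous_deriv_sineMean hψ
  have hq : Continuous ↿fun y u : ℝ => √u / 2 * deriv (sineMean ψ) √(u * y) := by
    simp only [Function.HasUncurry.uncurry]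
    fun_prop
  refine ae_eq_zero_of_volterra hG hG0 hq (c := sineMean ψ 0) ?_ (ae_deriv_volterra hG hG0 hq _
    (k := fun y u => sineMean ψ √(u * y)) (fun u hu y hy => ?_)
    (ae_abel_volterra hG hG0 hψ.continuous h))
  · rw [sineMean_zero]
    exact mul_ne_zero pi_ne_zero hψ0
  · rw [integral_deriv_comp_sqrt_mul hdiff hcont hu.1 hy.1]
    ring

/-- Theorem 2.7: vanishing of the integral operator with kernel
`H((su-u²)^{1/2}) (su-u²)^{(n-3)/2}` (for even `n ≥ 2`) forces `F ≡ 0` on `[0,1]`. -/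
theorem thm_2_7 (n : ℕ) (hn : 2 ≤ n) (hne : Even n) (F H : ℝ → ℝ)
    (hF : ContinuousOn F (Icc 0 1)) (hH : ContDiff ℝ (⊤ : ℕ∞) H) (hH0 : H 0 ≠ 0)
    (heq : ∀ s ∈ Icc (0:ℝ) 1, ∫ u in (0:ℝ)..s,
      F u * H (Real.sqrt (s * u - u ^ 2)) * (s * u - u ^ 2) ^ (((n : ℝ) - 3) / 2) = 0) :
    EqOn F 0 (Icc 0 1) := by
  obtain ⟨j, rfl⟩ : ∃ j, n = 2 * (j + 1) := by
    obtain ⟨r, hr⟩ := hne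
    exact ⟨r - 1, by omega⟩
  set G : ℝ → ℝ := indicator (Ioo 0 1) fun u => (√u)⁻¹ * (F u * u ^ j) with hGdef
  have hG : Integrable G := by
    rw [hGdef, integrable_indicator_iff measurableSet_Ioo]
    refine ((intervalIntegrable_iff_integrableOn_Ioc_of_le zero_le_one).1
      ((intervalIntegrable_inv_sqrt 0 1).mul_continuousOn ?_)).mono_set Ioo_subset_Ioc_self
    rw [uIcc_of_le zero_le_one]
    exact hF.mul (by fun_prop)
  have hG0 : ∀ u ∉ Ioo (0 : ℝ) 1, G u = 0 := fun u hu => indicator_of_notMem hu _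
  have hstart : ∀ᵐ s, s ∈ Ioo (0 : ℝ) 1 → ∫ u in (0 : ℝ)..s,
      G u * ((√(s - u))⁻¹ * ((s - u) ^ j * H √(u * (s - u)))) = 0 := by
    refine Filter.Eventually.of_forall fun s hs => ?_
    refine Eq.trans ?_ (heq s (Ioo_subset_Icc_self hs))
    rw [integral_of_le hs.1.le, integral_of_le hs.1.le,
      integral_Ioc_eq_integral_Ioo, integral_Ioc_eq_integral_Ioo]
    refine setIntegral_congr_fun measurableSet_Ioo fun u hu => ?_
    have h1 : s * u - u ^ 2 = u * (s - u) := by ring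
    have hu0 : 0 < u := hu.1
    have hsu : 0 < s - u := sub_pos.2 hu.2
    have h2 : (u * (s - u)) ^ ((((2 * (j + 1) : ℕ) : ℝ) - 3) / 2) =
        (√u)⁻¹ * (√(s - u))⁻¹ * (u ^ j * (s - u) ^ j) := by
      rw [← mul_inv, ← sqrt_mul hu0.le, ← mul_pow, sqrt_eq_rpow,
        ← rpow_neg (mul_pos hu0 hsu).le, ← rpow_natCast, ← rpow_add (mul_pos hu0 hsu)]
      congr 1
      push_cast
      ring
    have h3 : G u = (√u)⁻¹ * (F u * u ^ j) := 
      indicator_of_mem (s := Ioo 0 1) ⟨hu0, hu.2.trans hs.2⟩ _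
    simp only [h1, h2, h3]
    ring
  obtain ⟨ψ, hψ, hψ0, hψeq⟩ := exists_abel_volterra hG hG0 j H hH hH0 hstart
  have hGzero := ae_eq_zero_of_abel_volterra hG hG0 (hψ.of_le (by simp)) hψ0 hψeq
  refine Measure.eqOn_Icc_of_ae_eq volume zero_ne_one ?_ hF continuousOn_const
  rw [← restrict_Ioo_eq_restrict_Icc]
  refine (ae_restrict_iff' measurableSet_Ioo).2 ?_
  filter_upwards [hGzero] with u hu hu1
  have h3 : G u = (√u)⁻¹ * (F u * u ^ j) := indicator_of_mem hu1 _
  have h4 : √u ≠ 0 := (sqrt_pos.2 hu1.1).ne'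
  simpa [h3, h4, hu1.1.ne'] using hu
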